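/- For every integer g ≥ 1 and every τ ∈ ℍ_g: (f₄^{(g)}(τ))² − f₈^{(g)}(τ) = 2^{−2g}·((1 − 2^g)·S_{0,16}^g(τ) + 2·S_{1,8}^g(τ)); equivalently, F_g(τ) = −2^{2g}·((f₄^{(g)}(τ))² − f₈^{(g)}(τ)). -/

import Mathlib

open scoped BigOperators

noncomputable section

/-- The Siegel upper half-space: symmetric complex matrices with positive
definite imaginary part (indexed by a finite type `ι`). -/
def Siegel (ι : Type) [Fintype ι] : Set (Matrix ι ι ℂ) :=
  {τ | τ.IsSymm ∧ ∀ v : ι → ℝ, v ≠ 0 → 0 < ∑ i, ∑ j, v i * (τ i j).im * v j}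

/-- The theta function with characteristic `[ε, δ]`. -/
def theta {ι : Type} [Fintype ι] (ε δ : ι → ZMod 2) (τ : Matrix ι ι ℂ) (z : ι → ℂ) : ℂ :=
  ∑' n : ι → ℤ, Complex.exp ((Real.pi : ℂ) * Complex.I *
    ((∑ i, ∑ j, ((n i : ℂ) + ((ε i).val : ℂ) / 2) * τ i j * ((n j : ℂ) + ((ε j).val : ℂ) / 2)) +
     2 * ∑ i, ((n i : ℂ) + ((ε i).val : ℂ) / 2) * (z i + ((δ i).val : ℂ) / 2)))

/-- A theta characteristic, an element of `𝔽₂^{2g}`. -/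
abbrev Char2 (ι : Type) := (ι → ZMod 2) × (ι → ZMod 2)

/-- Theta function, with the characteristic as a pair. -/
def thetaChar {ι : Type} [Fintype ι] (m : Char2 ι) (τ : Matrix ι ι ℂ) (z : ι → ℂ) : ℂ :=
  theta m.1 m.2 τ z

/-- Theta constant. -/
def thetaConst {ι : Type} [Fintype ι] (m : Char2 ι) (τ : Matrix ι ι ℂ) : ℂ :=
  thetaChar m τ 0

/-- `W` is (the underlying finite set of) an `i`-dimensional affine subspace of `𝔽₂^{2g}`,
i.e. a coset of an `i`-dimensional linear subspace. -/
def IsAffineCosetDim {ι : Type} [Fintype ι] (i : ℕ) (W : Finset (Char2 ι)) : Prop :=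
  ∃ (V : Submodule (ZMod 2) (Char2 ι)) (x : Char2 ι),
    Module.finrank (ZMod 2) V = i ∧ (W : Set (Char2 ι)) = (fun v => x + v) '' (V : Set (Char2 ι))

/-- The modular form `S_{i,s}^g(τ) = Σ_W (Π_{w∈W} θ_w(τ))^s`, the sum over all
`i`-dimensional affine subspaces `W` of `𝔽₂^{2g}`, each counted once. -/
noncomputable def Sform (ι : Type) [Fintype ι] (i s : ℕ) (τ : Matrix ι ι ℂ) : ℂ :=
  letI := Classical.propDecidable
  ∑ W ∈ Finset.univ.filter (fun W : Finset (Char2 ι) => IsAffineCosetDim i W),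
    (∏ w ∈ W, thetaConst w τ) ^ s

/-- The even unimodular lattice `{x ∈ ℤ^k ∪ (ℤ+1/2)^k : Σᵢ xᵢ ∈ 2ℤ}` (the `E₈` lattice
for `k = 8`, the `D₁₆⁺` lattice for `k = 16`). -/
def evenLattice (k : ℕ) : Set (Fin k → ℝ) :=
  {x | ((∀ i, ∃ n : ℤ, x i = n) ∨ (∀ i, ∃ n : ℤ, x i = n + 1/2)) ∧
        ∃ m : ℤ, ∑ i, x i = 2 * m}

/-- The genus-`g` theta series of the lattice `evenLattice k`; for `k = 8` this is
`f₄^{(g)}` and for `k = 16` this is `f₈^{(g)}`. -/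
noncomputable def latticeTheta (k : ℕ) (ι : Type) [Fintype ι] (τ : Matrix ι ι ℂ) : ℂ :=
  ∑' u : ι → evenLattice k, Complex.exp ((Real.pi : ℂ) * Complex.I *
    ∑ a, ∑ b, (((∑ i, (u a : Fin k → ℝ) i * (u b : Fin k → ℝ) i : ℝ)) : ℂ) * τ a b)

/-- The modular form `F_g(τ) = 2^g·Σ_m θ_m(τ)^{16} − (Σ_m θ_m(τ)^8)²`. -/
noncomputable def Fmod (ι : Type) [Fintype ι] [DecidableEq ι] (τ : Matrix ι ι ℂ) : ℂ :=
  2 ^ (Fintype.card ι) * ∑ m : Char2 ι, thetaConst m τ ^ 16 -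
    (∑ m : Char2 ι, thetaConst m τ ^ 8) ^ 2

theorem summable_norm_and_tsum_fin_pi_prod {α : Type*} {k : ℕ} {f : Fin k → α → ℂ}
    (hf : ∀ i, Summable fun x => ‖f i x‖) :
    Summable (fun x : Fin k → α => ‖∏ i, f i (x i)‖) ∧
      ∑' x : Fin k → α, ∏ i, f i (x i) = ∏ i, ∑' x, f i x := by
  induction k with
  | zero => exact ⟨(hasSum_fintype _).summable, by simp⟩
  | succ k ih =>
    obtain ⟨hs, ht⟩ := ih (f := fun i => f i.succ) fun i => hf i.succ
    let e : α × (Fin k → α) ≃ (Fin (k + 1) → α) := Fin.consEquiv fun _ => α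
    have he (p : α × (Fin k → α)) :
        ∏ i, f i (e p i) = f 0 p.1 * ∏ i : Fin k, f i.succ (p.2 i) := by
      rw [Fin.prod_univ_succ]
      simp [e, Fin.consEquiv]
    constructor
    · rw [← e.summable_iff]
      exact (Summable.mul_norm (hf 0) hs).congr fun p => by simp only [Function.comp, he]
    · rw [← e.tsum_eq, Fin.prod_univ_succ, ← ht, tsum_mul_tsum_of_summable_norm (hf 0) hs]
      exact tsum_congr he

theorem isAffineCosetDim_zero_iff {ι : Type} [Fintype ι] (W : Finset (Char2 ι)) :
    IsAffineCosetDim 0 W ↔ W.card = 1 := by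
  rw [Finset.card_eq_one]
  constructor
  · rintro ⟨V, x, hV, hW⟩
    rw [Submodule.finrank_eq_zero] at hV
    subst hV
    refine ⟨x, ?_⟩
    rw [← Finset.coe_inj, hW]
    simp
  · rintro ⟨x, rfl⟩
    exact ⟨⊥, x, by simp, by simp⟩

theorem isAffineCosetDim_one_iff {ι : Type} [Fintype ι] (W : Finset (Char2 ι)) :
    IsAffineCosetDim 1 W ↔ W.card = 2 := by
  constructor
  · rintro ⟨V, x, hV, hW⟩
    have h := Module.natCard_eq_pow_finrank (K := ZMod 2) (V := V)
    rw [hV, Nat.card_zmod, pow_one] at h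
    rw [← Set.ncard_coe_finset, hW, Set.ncard_image_of_injective _ (add_right_injective x)]
    exact h
  · classical
    rw [Finset.card_eq_two]
    rintro ⟨x, y, hxy, rfl⟩
    refine ⟨Submodule.span (ZMod 2) {y - x}, x,
      finrank_span_singleton (sub_ne_zero.mpr hxy.symm), ?_⟩
    ext z
    simp only [Finset.coe_insert, Finset.coe_singleton, Set.mem_insert_iff,
      Set.mem_singleton_iff, Set.mem_image, SetLike.mem_coe, Submodule.mem_span_singleton]
    constructor
    · rintro (rfl | rfl)
      · exact ⟨0, ⟨0, by simp⟩, by simp⟩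
      · exact ⟨z - x, ⟨1, by simp⟩, by simp⟩
    · rintro ⟨_, ⟨a, rfl⟩, rfl⟩
      have ha : a = 0 ∨ a = 1 := by revert a; decide
      rcases ha with rfl | rfl <;> simp

theorem sq_sum_eq_sum_sq_add_two_mul {α R : Type*} [DecidableEq α] [CommRing R]
    (s : Finset α) (a : α → R) :
    (∑ x ∈ s, a x) ^ 2 = ∑ x ∈ s, a x ^ 2 + 2 * ∑ t ∈ s.powersetCard 2, ∏ x ∈ t, a x := by
  induction s using Finset.induction_on with
  | empty =>
    rw [Finset.powersetCard_eq_empty.mpr (by simp)]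
    simp
  | insert x s hx ih =>
    have hinj : Set.InjOn (insert x) (s.powersetCard 1 : Set (Finset α)) := by
      intro t ht u hu htu
      have ht' : x ∉ t := fun h => hx ((Finset.mem_powersetCard.mp ht).1 h)
      have hu' : x ∉ u := fun h => hx ((Finset.mem_powersetCard.mp hu).1 h)
      rw [← Finset.erase_insert ht', htu, Finset.erase_insert hu']
    have hdisj : Disjoint (s.powersetCard 2) ((s.powersetCard 1).image (insert x)) := by
      rw [Finset.disjoint_left]
      rintro t ht ht'
      obtain ⟨u, -, rfl⟩ := Finset.mem_image.mp ht'
      exact hx ((Finset.mem_powersetCard.mp ht).1 (Finset.mem_insert_self x u))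
    have hpair : ∑ t ∈ s.powersetCard 1, ∏ y ∈ insert x t, a y = a x * ∑ y ∈ s, a y := by
      rw [Finset.powersetCard_one, Finset.sum_map, Finset.mul_sum]
      refine Finset.sum_congr rfl fun y hy => ?_
      exact Finset.prod_pair fun h => hx (h ▸ hy)
    rw [Finset.powersetCard_succ_insert hx, Finset.sum_union hdisj, Finset.sum_image hinj,
      hpair, Finset.sum_insert hx, Finset.sum_insert hx, add_sq, ih]
    ring

theorem Sform_zero (ι : Type) [Fintype ι] [DecidableEq ι] (s : ℕ) (τ : Matrix ι ι ℂ) :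
    Sform ι 0 s τ = ∑ m : Char2 ι, thetaConst m τ ^ s := by
  have h : (Finset.univ.filter fun W : Finset (Char2 ι) => W.card = 1) =
      (Finset.univ : Finset (Char2 ι)).powersetCard 1 := by
    ext W; simp [Finset.mem_powersetCard]
  unfold Sform
  simp only [isAffineCosetDim_zero_iff]
  trans ∑ W ∈ (Finset.univ : Finset (Char2 ι)).powersetCard 1, (∏ w ∈ W, thetaConst w τ) ^ s
  · rw [← h]; congr!
  · rw [Finset.powersetCard_one, Finset.sum_map]
    simp

theorem Sform_one (ι : Type) [Fintype ι] [DecidableEq ι] (s : ℕ) (τ : Matrix ι ι ℂ) :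
    2 * Sform ι 1 s τ =
      (∑ m : Char2 ι, thetaConst m τ ^ s) ^ 2 - ∑ m : Char2 ι, thetaConst m τ ^ (s * 2) := by
  have h : (Finset.univ.filter fun W : Finset (Char2 ι) => W.card = 2) =
      (Finset.univ : Finset (Char2 ι)).powersetCard 2 := by
    ext W; simp [Finset.mem_powersetCard]
  have hS : Sform ι 1 s τ = ∑ W ∈ (Finset.univ : Finset (Char2 ι)).powersetCard 2,
      ∏ w ∈ W, thetaConst w τ ^ s := by
    unfold Sform
    simp only [isAffineCosetDim_one_iff, ← Finset.prod_pow]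
    rw [← h]; congr!
  rw [hS, sq_sum_eq_sum_sq_add_two_mul]
  simp only [pow_mul]
  ring

theorem exists_coercive_of_mem_Siegel {ι : Type} [Fintype ι] {τ : Matrix ι ι ℂ}
    (hτ : τ ∈ Siegel ι) :
    ∃ c : ℝ, 0 < c ∧ ∀ v : ι → ℝ, c * ∑ i, v i ^ 2 ≤ ∑ i, ∑ j, v i * (τ i j).im * v j := by
  let q : EuclideanSpace ℝ ι → ℝ := fun v => ∑ i, ∑ j, v i * (τ i j).im * v j
  have hq : Continuous q := by fun_prop
  obtain ⟨c, hc, hcq⟩ : ∃ c : ℝ, 0 < c ∧ ∀ v ∈ Metric.sphere (0 : EuclideanSpace ℝ ι) 1,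
      c ≤ q v := by
    rcases (Metric.sphere (0 : EuclideanSpace ℝ ι) 1).eq_empty_or_nonempty with h | h
    · exact ⟨1, one_pos, by simp [h]⟩
    · obtain ⟨v, hv, hmin⟩ := (isCompact_sphere _ _).exists_isMinOn h hq.continuousOn
      refine ⟨q v, hτ.2 v fun h0 => ?_, fun w hw => hmin hw⟩
      have : v = 0 := by ext i; exact congrFun h0 i
      simp [this] at hv
  refine ⟨c, hc, fun v => ?_⟩
  rcases eq_or_ne v 0 with rfl | hv
  · simp
  · let w : EuclideanSpace ℝ ι := WithLp.toLp 2 v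
    have hw : 0 < ‖w‖ := norm_pos_iff.mpr fun h => hv (by
      ext i; exact congrFun (congrArg WithLp.ofLp h) i)
    have hn : ∑ i, v i ^ 2 = ‖w‖ ^ 2 := by rw [EuclideanSpace.real_norm_sq_eq]
    have h1 := hcq (‖w‖⁻¹ • w) (by simp [norm_smul, hw.ne'])
    have h2 : q (‖w‖⁻¹ • w) = (‖w‖ ^ 2)⁻¹ * ∑ i, ∑ j, v i * (τ i j).im * v j := by
      simp only [q, w, Finset.mul_sum, PiLp.smul_apply, smul_eq_mul]
      refine Finset.sum_congr rfl fun i _ => Finset.sum_congr rfl fun j _ => ?_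
      ring
    rw [h2, inv_mul_eq_div, le_div_iff₀ (by positivity)] at h1
    rwa [hn]

/-- The Gaussian `exp(πi·vᵀτv)` of a real vector. -/
def gaussExp {ι : Type} [Fintype ι] (τ : Matrix ι ι ℂ) (v : ι → ℝ) : ℂ :=
  Complex.exp ((Real.pi : ℂ) * Complex.I * ∑ i, ∑ j, (v i : ℂ) * τ i j * (v j : ℂ))

/-- The shifted lattice point `n + ε/2`. -/
def halfShift {ι : Type} (ε : ι → ZMod 2) (n : ι → ℤ) (i : ι) : ℝ :=
  n i + ((ε i).val : ℝ) / 2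

theorem norm_gaussExp {ι : Type} [Fintype ι] (τ : Matrix ι ι ℂ) (v : ι → ℝ) :
    ‖gaussExp τ v‖ = Real.exp (-Real.pi * ∑ i, ∑ j, v i * (τ i j).im * v j) := by
  rw [gaussExp, Complex.norm_exp, mul_assoc, Complex.re_ofReal_mul, Complex.I_mul_re,
    Complex.im_sum, mul_neg, neg_mul]
  simp only [Complex.im_sum, Complex.im_mul_ofReal, Complex.im_ofReal_mul]

theorem summable_norm_gaussExp_halfShift {g : ℕ} {τ : Matrix (Fin g) (Fin g) ℂ}
    (hτ : τ ∈ Siegel (Fin g)) (ε : Fin g → ZMod 2) :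
    Summable fun n : Fin g → ℤ => ‖gaussExp τ (halfShift ε n)‖ := by
  obtain ⟨c, hc, hcτ⟩ := exists_coercive_of_mem_Siegel hτ
  let f : Fin g → ℤ → ℂ := fun i n =>
    (Real.exp (-Real.pi * (n + ((ε i).val : ℝ) / 2) ^ 2 * c) : ℝ)
  have hf (i : Fin g) : Summable fun n => ‖f i n‖ := by
    simpa [f, -Complex.ofReal_exp, Complex.norm_real] using
      (HurwitzZeta.hasSum_int_evenKernel (((ε i).val : ℝ) / 2) hc).summable
  refine Summable.of_nonneg_of_le (fun _ => norm_nonneg _) (fun n => ?_)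
    (summable_norm_and_tsum_fin_pi_prod hf).1
  have hprod : ‖∏ i, f i (n i)‖ = Real.exp (-Real.pi * (c * ∑ i, halfShift ε n i ^ 2)) := by
    rw [norm_prod, Finset.mul_sum, Finset.mul_sum, Real.exp_sum]
    refine Finset.prod_congr rfl fun i _ => ?_
    rw [Complex.norm_real, Real.norm_of_nonneg (Real.exp_pos _).le, halfShift]
    congr 1
    ring
  rw [hprod, norm_gaussExp]
  exact Real.exp_le_exp.mpr
    (mul_le_mul_of_nonpos_left (hcτ _) (neg_nonpos.mpr Real.pi_pos.le))

theorem thetaConst_eq_tsum {ι : Type} [Fintype ι] (ε δ : ι → ZMod 2) (τ : Matrix ι ι ℂ) :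
    thetaConst (ε, δ) τ = ∑' n : ι → ℤ, gaussExp τ (halfShift ε n) *
      ∏ i, Complex.exp (Real.pi * Complex.I * halfShift ε n i * ((δ i).val : ℂ)) := by
  refine tsum_congr fun n => ?_
  rw [gaussExp, ← Complex.exp_sum, ← Complex.exp_add, mul_add]
  congr 2
  · simp [halfShift, -ZMod.natCast_val]
  · rw [Finset.mul_sum, Finset.mul_sum]
    refine Finset.sum_congr rfl fun i _ => ?_
    simp only [halfShift, Pi.zero_apply]
    push_cast
    ring

theorem thetaConst_pow {g : ℕ} {τ : Matrix (Fin g) (Fin g) ℂ} (hτ : τ ∈ Siegel (Fin g))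
    (ε δ : Fin g → ZMod 2) (j : ℕ) :
    thetaConst (ε, δ) τ ^ (4 * j) = ∑' N : Fin (4 * j) → Fin g → ℤ,
      (∏ r, gaussExp τ (halfShift ε (N r))) * ∏ i, ((-1 : ℂ) ^ (∑ r, N r i)) ^ (δ i).val := by
  have hnorm (n : Fin g → ℤ) : ‖gaussExp τ (halfShift ε n) *
      ∏ i, Complex.exp (Real.pi * Complex.I * halfShift ε n i * ((δ i).val : ℂ))‖ =
      ‖gaussExp τ (halfShift ε n)‖ := by
    rw [norm_mul, norm_prod, Finset.prod_eq_one, mul_one]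
    intro i _
    rw [Complex.norm_exp]
    simp [-ZMod.natCast_val]
  have hs := summable_norm_gaussExp_halfShift hτ ε
  simp only [← hnorm] at hs
  have := (summable_norm_and_tsum_fin_pi_prod (k := 4 * j) fun _ => hs).2
  rw [thetaConst_eq_tsum, ← Fin.prod_const, ← this]
  refine tsum_congr fun N => ?_
  rw [Finset.prod_mul_distrib, Finset.prod_comm]
  congr 1
  refine Finset.prod_congr rfl fun i _ => ?_
  rw [← Complex.exp_sum, ← Finset.sum_mul, ← Finset.mul_sum, mul_comm _ ((δ i).val : ℂ),
    Complex.exp_nat_mul]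
  congr 1
  have hsum : ∑ r, (halfShift ε (N r) i : ℂ) =
      ((∑ r, N r i : ℤ) : ℂ) + ((j * (ε i).val : ℕ) : ℂ) * 2 := by
    simp only [halfShift]
    push_cast
    rw [Finset.sum_add_distrib]
    simp
    ring
  rw [hsum, mul_add, Complex.exp_add, mul_comm _ ((∑ r, N r i : ℤ) : ℂ), Complex.exp_int_mul,
    Complex.exp_pi_mul_I]
  have : (Real.pi : ℂ) * Complex.I * (((j * (ε i).val : ℕ) : ℂ) * 2) =
      ((j * (ε i).val : ℕ) : ℂ) * (2 * Real.pi * Complex.I) := by ring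
  rw [this, Complex.exp_nat_mul_two_pi_mul_I, mul_one]

theorem sum_prod_neg_one_pow {g : ℕ} (s : Fin g → ℤ) :
    ∑ δ : Fin g → ZMod 2, ∏ i, ((-1 : ℂ) ^ s i) ^ (δ i).val =
      if ∀ i, Even (s i) then 2 ^ g else 0 := by
  have h := Finset.prod_univ_sum (fun _ : Fin g => (Finset.univ : Finset (ZMod 2)))
    fun i d => ((-1 : ℂ) ^ s i) ^ d.val
  rw [Fintype.piFinset_univ] at h
  rw [← h]
  have h2 (i : Fin g) : ∑ d : ZMod 2, ((-1 : ℂ) ^ s i) ^ d.val = 1 + (-1) ^ s i := by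
    change ∑ d : Fin 2, ((-1 : ℂ) ^ s i) ^ (d : ℕ) = _
    simp [Fin.sum_univ_two]
  simp only [h2]
  split_ifs with hs
  · rw [Finset.prod_congr rfl fun i _ => by rw [(hs i).neg_one_zpow, one_add_one_eq_two]]
    simp
  · push Not at hs
    obtain ⟨i, hi⟩ := hs
    refine Finset.prod_eq_zero (Finset.mem_univ i) ?_
    rw [(Int.not_even_iff_odd.mp hi).neg_one_zpow, add_neg_cancel]

theorem mem_evenLattice_halfShift {ι : Type} (ε : ι → ZMod 2) (j : ℕ)
    (N : Fin (4 * j) → ι → ℤ) (a : ι) (h : Even (∑ r, N r a)) :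
    (fun r => halfShift ε (N r) a) ∈ evenLattice (4 * j) := by
  constructor
  · have ha : ε a = 0 ∨ ε a = 1 := by generalize ε a = e; revert e; decide
    rcases ha with ha | ha
    · exact Or.inl fun r => ⟨N r a, by simp [halfShift, ha]⟩
    · exact Or.inr fun r => ⟨N r a, by simp [halfShift, ha, ZMod.val_one]⟩
  · obtain ⟨m, hm⟩ := h
    refine ⟨m + j * (ε a).val, ?_⟩
    have : ((∑ r, N r a : ℤ) : ℝ) = m + m := by rw [hm]; push_cast; ring
    push_cast at this
    simp only [halfShift, Finset.sum_add_distrib, this]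
    simp
    ring

theorem exists_halfShift_of_mem_evenLattice {j : ℕ} {x : Fin (4 * j) → ℝ}
    (hx : x ∈ evenLattice (4 * j)) :
    ∃ (e : ZMod 2) (n : Fin (4 * j) → ℤ), Even (∑ r, n r) ∧ ∀ r, x r = n r + (e.val : ℝ) / 2 := by
  obtain ⟨e, n, hn⟩ : ∃ (e : ZMod 2) (n : Fin (4 * j) → ℤ), ∀ r, x r = n r + (e.val : ℝ) / 2 := by
    rcases hx.1 with h | h
    · choose n hn using h
      exact ⟨0, n, by simpa using hn⟩
    · choose n hn using h
      exact ⟨1, n, by simpa [ZMod.val_one] using hn⟩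
  refine ⟨e, n, ?_, hn⟩
  obtain ⟨m, hm⟩ := hx.2
  refine ⟨m - j * e.val, ?_⟩
  simp only [hn, Finset.sum_add_distrib] at hm
  simp [-ZMod.natCast_val] at hm
  have : ((∑ r, n r : ℤ) : ℝ) = ((m - j * e.val + (m - j * e.val) : ℤ) : ℝ) := by
    push_cast
    linarith
  exact_mod_cast this

/-- Pairs `(ε, N)` for which every column sum of `N` is even. -/
def evenPairs (g k : ℕ) : Set ((Fin g → ZMod 2) × (Fin k → Fin g → ℤ)) :=
  {p | ∀ a, Even (∑ r, p.2 r a)}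

/-- The tuple of lattice vectors `u_a = (N_{r,a} + ε_a/2)_r`. -/
def latticeTuple (g j : ℕ) (p : evenPairs g (4 * j)) (a : Fin g) : evenLattice (4 * j) :=
  ⟨fun r => halfShift p.1.1 (p.1.2 r) a, mem_evenLattice_halfShift _ _ _ _ (p.2 a)⟩

theorem eq_of_halfShift_eq {ι : Type} {ε ε' : ι → ZMod 2} {n n' : ι → ℤ} {a : ι}
    (h : halfShift ε n a = halfShift ε' n' a) : ε a = ε' a ∧ n a = n' a := by
  have hlt := ZMod.val_lt (ε a)
  have hlt' := ZMod.val_lt (ε' a)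
  have h2 : 2 * n a + ((ε a).val : ℤ) = 2 * n' a + ((ε' a).val : ℤ) := by
    have : 2 * (n a : ℝ) + ((ε a).val : ℝ) = 2 * n' a + ((ε' a).val : ℝ) := by
      simp only [halfShift] at h
      linarith
    exact_mod_cast this
  exact ⟨ZMod.val_injective 2 (by omega), by omega⟩

theorem latticeTuple_bijective (g : ℕ) {j : ℕ} (hj : 0 < j) :
    Function.Bijective (latticeTuple g j) := by
  constructor
  · rintro ⟨⟨ε, N⟩, hp⟩ ⟨⟨ε', N'⟩, hp'⟩ h
    have h2 (a : Fin g) (r : Fin (4 * j)) : ε a = ε' a ∧ N r a = N' r a :=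
      eq_of_halfShift_eq (congrFun (congrArg Subtype.val (congrFun h a)) r)
    have hε : ε = ε' := funext fun a => (h2 a ⟨0, by omega⟩).1
    have hN : N = N' := funext fun r => funext fun a => (h2 a r).2
    subst hε hN
    rfl
  · intro u
    choose e n hn hu using fun a => exists_halfShift_of_mem_evenLattice (u a).2
    refine ⟨⟨(e, fun r a => n a r), hn⟩, ?_⟩
    funext a
    ext r
    exact (hu a r).symm

theorem prod_gaussExp_latticeTuple {g j : ℕ} (τ : Matrix (Fin g) (Fin g) ℂ)
    (p : evenPairs g (4 * j)) :
    Complex.exp ((Real.pi : ℂ) * Complex.I * ∑ a, ∑ b,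
      (((∑ i, (latticeTuple g j p a : Fin (4 * j) → ℝ) i *
        (latticeTuple g j p b : Fin (4 * j) → ℝ) i : ℝ)) : ℂ) * τ a b) =
      ∏ r, gaussExp τ (halfShift p.1.1 (p.1.2 r)) := by
  simp only [gaussExp]
  rw [← Complex.exp_sum, ← Finset.mul_sum]
  congr 2
  symm
  rw [Finset.sum_comm]
  refine Finset.sum_congr rfl fun a _ => ?_
  rw [Finset.sum_comm]
  refine Finset.sum_congr rfl fun b _ => ?_
  rw [Complex.ofReal_sum, Finset.sum_mul]
  refine Finset.sum_congr rfl fun r _ => ?_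
  simp only [latticeTuple]
  push_cast
  ring

theorem two_pow_mul_latticeTheta {g : ℕ} {τ : Matrix (Fin g) (Fin g) ℂ}
    (hτ : τ ∈ Siegel (Fin g)) {j : ℕ} (hj : 0 < j) :
    2 ^ g * latticeTheta (4 * j) (Fin g) τ = ∑ m : Char2 (Fin g), thetaConst m τ ^ (4 * j) := by
  let G : (Fin g → ZMod 2) × (Fin (4 * j) → Fin g → ℤ) → ℂ :=
    fun p => ∏ r, gaussExp τ (halfShift p.1 (p.2 r))
  have hGε (ε : Fin g → ZMod 2) : Summable fun N => ‖G (ε, N)‖ :=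
    (summable_norm_and_tsum_fin_pi_prod fun _ => summable_norm_gaussExp_halfShift hτ ε).1
  have hG : Summable fun p => ‖G p‖ :=
    (summable_prod_of_nonneg fun _ => norm_nonneg _).mpr ⟨hGε, (hasSum_fintype _).summable⟩
  have hGi : Summable ((evenPairs g (4 * j)).indicator G) := hG.of_norm.indicator _
  have hlat : latticeTheta (4 * j) (Fin g) τ =
      ∑ ε, ∑' N, (evenPairs g (4 * j)).indicator G (ε, N) := by
    rw [latticeTheta, ← (Equiv.ofBijective _ (latticeTuple_bijective g hj)).tsum_eq]
    simp only [Equiv.ofBijective_apply, prod_gaussExp_latticeTuple]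
    rw [← tsum_fintype (L := .unconditional _), ← hGi.tsum_prod, ← tsum_subtype]
  rw [hlat, Fintype.sum_prod_type, Finset.mul_sum]
  refine Finset.sum_congr rfl fun ε _ => ?_
  simp only [thetaConst_pow hτ]
  rw [← Summable.tsum_finsetSum, ← tsum_mul_left]
  · refine tsum_congr fun N => ?_
    rw [← Finset.mul_sum, sum_prod_neg_one_pow]
    by_cases h : ∀ a, Even (∑ r, N r a)
    · rw [if_pos h, Set.indicator_of_mem (show (ε, N) ∈ evenPairs g (4 * j) from h), mul_comm]
    · rw [if_neg h, Set.indicator_of_notMem (show (ε, N) ∉ evenPairs g (4 * j) from h)]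
      simp
  · intro δ _
    refine Summable.of_norm ((hGε ε).congr fun N => ?_)
    rw [norm_mul]
    simp [G]

/-- Igusa's expression of `(f₄^{(g)})² − f₈^{(g)}` in terms of `S_{0,16}^g` and `S_{1,8}^g`,
and equivalently in terms of the form `F_g`. -/
theorem f4_sq_sub_f8_eq (g : ℕ) (hg : 1 ≤ g)
    (τ : Matrix (Fin g) (Fin g) ℂ) (hτ : τ ∈ Siegel (Fin g)) :
    latticeTheta 8 (Fin g) τ ^ 2 - latticeTheta 16 (Fin g) τ =
      (2 : ℂ)⁻¹ ^ (2 * g) *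
        ((1 - 2 ^ g) * Sform (Fin g) 0 16 τ + 2 * Sform (Fin g) 1 8 τ) ∧
    Fmod (Fin g) τ =
      -(2 : ℂ) ^ (2 * g) * (latticeTheta 8 (Fin g) τ ^ 2 - latticeTheta 16 (Fin g) τ) := by
  have h8 := two_pow_mul_latticeTheta hτ (j := 2) (by norm_num)
  have h16 := two_pow_mul_latticeTheta hτ (j := 4) (by norm_num)
  norm_num only at h8 h16
  have h0 : (2 : ℂ) ^ g ≠ 0 := pow_ne_zero g two_ne_zero
  have hpow : (2 : ℂ) ^ (2 * g) = (2 ^ g) ^ 2 := by ring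
  constructor
  · rw [Sform_zero, Sform_one, inv_pow, hpow, ← h8, ← h16]
    field_simp
    ring
  · rw [Fmod, Fintype.card_fin, hpow, ← h8, ← h16]
    ring
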